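/- (Lemma 1) Let G and H be rooted trees in each of which every internal vertex has at least two children, with leaf enumerations a_1, …, a_k of G and b_1, …, b_k of H. If the LCAG matrix of G under the enumeration a_1, …, a_k equals the LCAG matrix of H under the enumeration b_1, …, b_k, then G and H are isomorphic as rooted trees; in fact there is a graph isomorphism f from G to H mapping the root of G to the root of H with f(a_i) = b_i for all i. -/

import Mathlib

open scoped Classical

/-- A rooted tree: a finite tree (connected acyclic simple graph) together with a
distinguished vertex called the root. -/
structure RTree (V : Type*) [Fintype V] where
  G : SimpleGraph V
  isTree : G.IsTree
  root : V

namespace RTree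

variable {V : Type*} [Fintype V]

/-- `u` is an ancestor of `v`: `u` lies on the unique path from `v` to the root
(equivalently, the distances satisfy `dist root v = dist root u + dist u v`).
Every vertex is an ancestor of itself. -/
def Ancestor (T : RTree V) (u v : V) : Prop :=
  T.G.dist T.root v = T.G.dist T.root u + T.G.dist u v

/-- `v` is a child of `u`: `u` is the ancestor of `v` at graph distance `1`
(i.e. `u` is the parent of `v`). -/
noncomputable def IsChild (T : RTree V) (u v : V) : Prop :=
  T.Ancestor u v ∧ T.G.dist u v = 1

/-- A leaf is a vertex with no children. -/
def IsLeaf (T : RTree V) (u : V) : Prop := ∀ v, ¬ T.IsChild u v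

/-- The depth of a vertex is its graph distance from the root. -/
noncomputable def depth (T : RTree V) (v : V) : ℕ := T.G.dist T.root v

/-- `c` is the lowest common ancestor of `a` and `b`: a common ancestor of
maximal depth. -/
def IsLCA (T : RTree V) (c a b : V) : Prop :=
  T.Ancestor c a ∧ T.Ancestor c b ∧
    ∀ d, T.Ancestor d a → T.Ancestor d b → T.depth d ≤ T.depth c

/-- The lowest common ancestor of `a` and `b`. -/
noncomputable def lca (T : RTree V) (a b : V) : V :=
  haveI : Nonempty V := ⟨T.root⟩
  Classical.epsilon (fun c => T.IsLCA c a b)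

/-- The set of children of a vertex, as a finset. -/
noncomputable def childFinset (T : RTree V) (u : V) : Finset V :=
  Finset.univ.filter (fun v => T.IsChild u v)

/-- `g` is the generation function: `g u = 0` if `u` is a leaf, and
`g u = 1 + max of g v over the children v of u` otherwise. -/
def IsGenFun (T : RTree V) (g : V → ℕ) : Prop :=
  ∀ u, g u = if T.IsLeaf u then 0 else 1 + (T.childFinset u).sup g

/-- The generation function of the rooted tree. -/
noncomputable def gen (T : RTree V) : V → ℕ :=
  Classical.epsilon T.IsGenFun

/-- `v` is an enumeration of the leaves of `T`. -/
def IsLeafEnum (T : RTree V) {k : ℕ} (v : Fin k → V) : Prop :=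
  Function.Injective v ∧ ∀ u, T.IsLeaf u ↔ ∃ i, v i = u

/-- The LCAG matrix of `T` under the leaf enumeration `v`: its `(i,j)` entry is
`g (LCA (v i) (v j))`. -/
noncomputable def LCAG (T : RTree V) {k : ℕ} (v : Fin k → V) :
    Matrix (Fin k) (Fin k) ℕ :=
  Matrix.of fun i j => T.gen (T.lca (v i) (v j))

end RTree

namespace RTree

variable {V : Type*} [Fintype V]

lemma anc_refl (T : RTree V) (u : V) : T.Ancestor u u := by simp [Ancestor]

lemma anc_root (T : RTree V) (u : V) : T.Ancestor T.root u := by simp [Ancestor]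

lemma anc_trans (T : RTree V) {u v w : V} (h : T.Ancestor u v) (h' : T.Ancestor v w) :
    T.Ancestor u w := by
  unfold Ancestor at *
  have h1 := T.isTree.connected.dist_triangle (u := u) (v := v) (w := w)
  have h2 := T.isTree.connected.dist_triangle (u := T.root) (v := u) (w := w)
  omega

lemma anc_antisymm (T : RTree V) {u v : V} (h : T.Ancestor u v) (h' : T.Ancestor v u) :
    u = v := by
  unfold Ancestor at *
  exact T.isTree.connected.dist_eq_zero_iff.1 (by omega)

lemma anc_depth_lt (T : RTree V) {u v : V} (h : T.Ancestor u v) (hne : u ≠ v) :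
    T.depth u < T.depth v := by
  unfold Ancestor at h
  unfold depth
  have := T.isTree.connected.pos_dist_of_ne hne
  omega

lemma exists_parent (T : RTree V) {u v : V} (h : T.Ancestor u v) (hne : u ≠ v) :
    ∃ p, T.Ancestor u p ∧ T.IsChild p v := by
  obtain ⟨w, hw⟩ := T.isTree.connected.exists_walk_length_eq_dist v u
  cases w with
  | nil => exact absurd rfl hne
  | @cons _ p _ hadj q =>
    have h1 : T.G.dist p u ≤ q.length := SimpleGraph.dist_le q
    have h2 : T.G.dist p v = 1 := SimpleGraph.dist_eq_one_iff_adj.2 hadj.symm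
    have h3 := T.isTree.connected.dist_triangle (u := T.root) (v := p) (w := v)
    have h4 := T.isTree.connected.dist_triangle (u := T.root) (v := u) (w := p)
    have h5 := T.isTree.connected.dist_triangle (u := u) (v := p) (w := v)
    rw [SimpleGraph.dist_comm (u := p) (v := u)] at h1
    rw [SimpleGraph.dist_comm (u := v) (v := u), SimpleGraph.Walk.length_cons] at hw
    unfold IsChild Ancestor at *
    refine ⟨p, ?_, ?_, h2⟩ <;> omega

lemma parent_unique (T : RTree V) {p q v : V} (h : T.IsChild p v) (h' : T.IsChild q v) :
    p = q := by
  have key : ∀ p, T.IsChild p v → ∃ w : T.G.Walk v T.root, w.IsPath ∧ w.snd = p := by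
    intro p hp
    obtain ⟨w, hw⟩ := T.isTree.connected.exists_walk_length_eq_dist p T.root
    have hadj : T.G.Adj v p := (SimpleGraph.dist_eq_one_iff_adj.1 hp.2).symm
    refine ⟨SimpleGraph.Walk.cons hadj w, ?_, by simp⟩
    apply SimpleGraph.Walk.isPath_of_length_eq_dist
    have := hp.1
    unfold Ancestor at this
    rw [SimpleGraph.Walk.length_cons, hw, SimpleGraph.dist_comm, SimpleGraph.dist_comm (u := v), this, hp.2]
  obtain ⟨w, hw, rfl⟩ := key p h
  obtain ⟨w', hw', rfl⟩ := key q h'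
  have := T.isTree.IsAcyclic.path_unique ⟨w, hw⟩ ⟨w', hw'⟩
  rw [Subtype.mk.injEq] at this
  rw [this]

lemma child_ne (T : RTree V) {p v : V} (h : T.IsChild p v) : p ≠ v := by
  rintro rfl
  have := h.2
  simp at this

lemma anc_chain (T : RTree V) : ∀ (n : ℕ) (u v w : V), T.depth w = n → T.Ancestor u w →
    T.Ancestor v w → T.Ancestor u v ∨ T.Ancestor v u := by
  intro n
  induction n using Nat.strong_induction_on with
  | _ n ih =>
    intro u v w hn hu hv
    by_cases h1 : u = w
    · subst h1; exact Or.inr hv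
    by_cases h2 : v = w
    · subst h2; exact Or.inl hu
    obtain ⟨p, hp, hc⟩ := T.exists_parent hu h1
    obtain ⟨q, hq, hc'⟩ := T.exists_parent hv h2
    obtain rfl := T.parent_unique hc hc'
    exact ih _ (hn ▸ T.anc_depth_lt hc.1 (T.child_ne hc)) u v p rfl hp hq

lemma child_iff (T : RTree V) (u v : V) : T.IsChild u v ↔
    T.Ancestor u v ∧ u ≠ v ∧ ∀ w, T.Ancestor u w → T.Ancestor w v → w = u ∨ w = v := by
  constructor
  · intro h
    refine ⟨h.1, T.child_ne h, fun w h1 h2 => ?_⟩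
    by_contra hcon
    push Not at hcon
    have a1 := T.anc_depth_lt h1 hcon.1.symm
    have a2 := T.anc_depth_lt h2 hcon.2
    have a3 := h.1
    have a4 := h.2
    unfold Ancestor depth at *
    omega
  · rintro ⟨h, hne, hw⟩
    obtain ⟨p, hp, hc⟩ := T.exists_parent h hne
    rcases hw p hp hc.1 with rfl | rfl
    · exact hc
    · exact absurd rfl (T.child_ne hc)

lemma adj_iff (T : RTree V) (u v : V) : T.G.Adj u v ↔ T.IsChild u v ∨ T.IsChild v u := by
  constructor
  · intro h
    have h1 : T.G.dist u v = 1 := SimpleGraph.dist_eq_one_iff_adj.2 h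
    have h2 : T.G.dist v u = 1 := SimpleGraph.dist_eq_one_iff_adj.2 h.symm
    have h3 := T.isTree.connected.dist_triangle (u := T.root) (v := u) (w := v)
    have h4 := T.isTree.connected.dist_triangle (u := T.root) (v := v) (w := u)
    have h5 := T.isTree.dist_ne_of_adj T.root h
    unfold IsChild Ancestor
    omega
  · rintro (h | h)
    · exact SimpleGraph.dist_eq_one_iff_adj.1 h.2
    · exact (SimpleGraph.dist_eq_one_iff_adj.1 h.2).symm

lemma child_depth (T : RTree V) {u v : V} (h : T.IsChild u v) : T.depth v = T.depth u + 1 := by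
  have := h.1
  have h2 := h.2
  unfold Ancestor at this
  unfold depth
  omega

/-- A uniform bound of depths. -/
noncomputable def dbound (T : RTree V) : ℕ := Finset.univ.sup T.depth

lemma depth_le (T : RTree V) (u : V) : T.depth u ≤ T.dbound :=
  Finset.le_sup (f := T.depth) (Finset.mem_univ u)

/-- Explicit generation by fuel. -/
noncomputable def genAux (T : RTree V) : ℕ → V → ℕ
  | 0, _ => 0
  | n + 1, u => if T.IsLeaf u then 0 else 1 + (T.childFinset u).sup (T.genAux n)

lemma genAux_stable (T : RTree V) : ∀ (n m : ℕ) (u : V), T.dbound < T.depth u + n →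
    T.dbound < T.depth u + m → T.genAux n u = T.genAux m u := by
  intro n
  induction n with
  | zero => intro m u h; have := T.depth_le u; omega
  | succ n ih =>
    intro m u h h'
    cases m with
    | zero => have := T.depth_le u; omega
    | succ m =>
      unfold genAux
      congr 2
      refine Finset.sup_congr rfl fun v hv => ?_
      have hc := T.child_depth (Finset.mem_filter.1 hv).2
      exact ih m v (by omega) (by omega)

lemma gen_spec (T : RTree V) : T.IsGenFun T.gen := by
  apply Classical.epsilon_spec (p := T.IsGenFun)
  refine ⟨T.genAux (T.dbound + 1), fun u => ?_⟩
  rw [T.genAux_stable (T.dbound + 1) (T.dbound + 2) u (by omega) (by omega)]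
  rfl

lemma gen_child (T : RTree V) {u v : V} (h : T.IsChild u v) : T.gen v < T.gen u := by
  rw [T.gen_spec u, if_neg (fun hl => hl v h)]
  have : T.gen v ≤ (T.childFinset u).sup T.gen :=
    Finset.le_sup (by simp [childFinset, h])
  omega

lemma gen_lt (T : RTree V) : ∀ (n : ℕ) (u v : V), T.depth v = n → T.Ancestor u v → u ≠ v →
    T.gen v < T.gen u := by
  intro n
  induction n using Nat.strong_induction_on with
  | _ n ih =>
    intro u v hn h hne
    obtain ⟨p, hp, hc⟩ := T.exists_parent h hne
    have h1 := T.gen_child hc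
    by_cases hup : u = p
    · rwa [hup]
    · exact h1.trans (ih _ (hn ▸ T.anc_depth_lt hc.1 (T.child_ne hc)) u p rfl hp hup)

lemma exists_leaf (T : RTree V) (u : V) : ∃ v, T.IsLeaf v ∧ T.Ancestor u v := by
  induction hn : T.gen u using Nat.strong_induction_on generalizing u with
  | _ n ih =>
    by_cases hl : T.IsLeaf u
    · exact ⟨u, hl, T.anc_refl u⟩
    · unfold IsLeaf at hl
      push Not at hl
      obtain ⟨c, hc⟩ := hl
      obtain ⟨v, hv, hcv⟩ := ih _ (hn ▸ T.gen_child hc) c rfl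
      exact ⟨v, hv, T.anc_trans hc.1 hcv⟩

lemma lca_spec (T : RTree V) (x y : V) : T.IsLCA (T.lca x y) x y := by
  apply Classical.epsilon_spec (p := fun c => T.IsLCA c x y)
  obtain ⟨c, hc, hm⟩ := Finset.exists_max_image
    (Finset.univ.filter fun c => T.Ancestor c x ∧ T.Ancestor c y) T.depth
    ⟨T.root, by simp [T.anc_root]⟩
  simp only [Finset.mem_filter, Finset.mem_univ, true_and] at hc hm
  exact ⟨c, hc.1, hc.2, fun d h1 h2 => hm d ⟨h1, h2⟩⟩

lemma anc_lca (T : RTree V) {d x y : V} (h1 : T.Ancestor d x) (h2 : T.Ancestor d y) :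
    T.Ancestor d (T.lca x y) := by
  obtain ⟨a1, a2, a3⟩ := T.lca_spec x y
  rcases T.anc_chain _ _ _ _ rfl h1 a1 with h | h
  · exact h
  · by_cases he : T.lca x y = d
    · rw [he]; exact T.anc_refl d
    · have := T.anc_depth_lt h he
      have := a3 d h1 h2
      omega

lemma lca_self (T : RTree V) (x : V) : T.lca x x = x :=
  T.anc_antisymm (T.lca_spec x x).1 (T.anc_lca (T.anc_refl x) (T.anc_refl x))

lemma anc_iff_gen (T : RTree V) {u x y : V} (h : T.Ancestor u x) :
    T.Ancestor u y ↔ T.gen (T.lca x y) ≤ T.gen u := by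
  constructor
  · intro h2
    have h3 := T.anc_lca h h2
    by_cases he : u = T.lca x y
    · rw [← he]
    · exact (T.gen_lt _ _ _ rfl h3 he).le
  · intro h2
    obtain ⟨a1, a2, -⟩ := T.lca_spec x y
    rcases T.anc_chain _ _ _ _ rfl h a1 with h3 | h3
    · exact T.anc_trans h3 a2
    · by_cases he : T.lca x y = u
      · rwa [he] at a2
      · have := T.gen_lt _ _ _ rfl h3 he
        omega

lemma exists_lca_eq (T : RTree V) {k : ℕ} (a : Fin k → V)
    (hT2 : ∀ u, ¬ T.IsLeaf u → ∃ c₁ c₂, c₁ ≠ c₂ ∧ T.IsChild u c₁ ∧ T.IsChild u c₂)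
    (ha : T.IsLeafEnum a) (u : V) : ∃ i j, T.lca (a i) (a j) = u := by
  by_cases hl : T.IsLeaf u
  · obtain ⟨i, rfl⟩ := (ha.2 u).1 hl
    exact ⟨i, i, T.lca_self _⟩
  obtain ⟨c, d, hne, hc, hd⟩ := hT2 u hl
  obtain ⟨x, hx, hcx⟩ := T.exists_leaf c
  obtain ⟨y, hy, hdy⟩ := T.exists_leaf d
  obtain ⟨i, rfl⟩ := (ha.2 x).1 hx
  obtain ⟨j, rfl⟩ := (ha.2 y).1 hy
  refine ⟨i, j, ?_⟩
  have hu := T.anc_lca (T.anc_trans hc.1 hcx) (T.anc_trans hd.1 hdy)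
  obtain ⟨a1, a2, -⟩ := T.lca_spec (a i) (a j)
  by_contra hcon
  have key : ∀ c z, T.IsChild u c → T.Ancestor c z → T.Ancestor (T.lca (a i) (a j)) z →
      T.Ancestor c (T.lca (a i) (a j)) := by
    intro c z hc hcz hz
    rcases T.anc_chain _ _ _ _ rfl hcz hz with h | h
    · exact h
    · rcases ((T.child_iff u c).1 hc).2.2 _ hu h with h' | h'
      · exact absurd h' hcon
      · rw [h']; exact T.anc_refl c
  have k1 := key c _ hc hcx a1
  have k2 := key d _ hd hdy a2
  have e1 := T.child_depth hc
  have e2 := T.child_depth hd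
  rcases T.anc_chain _ _ _ _ rfl k1 k2 with h | h
  · have := T.anc_depth_lt h hne
    omega
  · have := T.anc_depth_lt h hne.symm
    omega

lemma anc_iff_leaves (T : RTree V) {k : ℕ} (a : Fin k → V)
    (hT2 : ∀ u, ¬ T.IsLeaf u → ∃ c₁ c₂, c₁ ≠ c₂ ∧ T.IsChild u c₁ ∧ T.IsChild u c₂)
    (ha : T.IsLeafEnum a) (u v : V) :
    T.Ancestor u v ↔ ∀ i, T.Ancestor v (a i) → T.Ancestor u (a i) := by
  constructor
  · exact fun h i hi => T.anc_trans h hi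
  · intro h
    obtain ⟨i, j, rfl⟩ := T.exists_lca_eq a hT2 ha v
    obtain ⟨a1, a2, -⟩ := T.lca_spec (a i) (a j)
    exact T.anc_lca (h i a1) (h j a2)

lemma lca_anc_iff (T : RTree V) {k : ℕ} (a : Fin k → V) (i j l : Fin k) :
    T.Ancestor (T.lca (a i) (a j)) (a l) ↔ T.LCAG a i l ≤ T.LCAG a i j :=
  T.anc_iff_gen (T.lca_spec (a i) (a j)).1

end RTree

/-- Lemma 1: If two rooted trees, in each of which every internal vertex
has at least two children, have equal LCAG matrices under leaf enumerations
`a` and `b`, then they are isomorphic as rooted trees; in fact there is a graph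
isomorphism mapping root to root with `f (a i) = b i` for all `i`. -/
theorem lcag_eq_implies_iso {V W : Type*} [Fintype V] [Fintype W]
    (T : RTree V) (S : RTree W) {k : ℕ} (a : Fin k → V) (b : Fin k → W)
    (hT2 : ∀ u, ¬ T.IsLeaf u → ∃ c₁ c₂, c₁ ≠ c₂ ∧ T.IsChild u c₁ ∧ T.IsChild u c₂)
    (hS2 : ∀ u, ¬ S.IsLeaf u → ∃ c₁ c₂, c₁ ≠ c₂ ∧ S.IsChild u c₁ ∧ S.IsChild u c₂)
    (ha : T.IsLeafEnum a) (hb : S.IsLeafEnum b)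
    (hmat : T.LCAG a = S.LCAG b) :
    ∃ f : T.G ≃g S.G, f T.root = S.root ∧ ∀ i, f (a i) = b i := by
  have hTS : ∀ u, ∃ w, ∀ l, T.Ancestor u (a l) ↔ S.Ancestor w (b l) := by
    intro u
    obtain ⟨i, j, rfl⟩ := T.exists_lca_eq a hT2 ha u
    exact ⟨S.lca (b i) (b j), fun l => by rw [T.lca_anc_iff, S.lca_anc_iff, hmat]⟩
  have hST : ∀ w, ∃ u, ∀ l, T.Ancestor u (a l) ↔ S.Ancestor w (b l) := by
    intro w
    obtain ⟨i, j, rfl⟩ := S.exists_lca_eq b hS2 hb w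
    exact ⟨T.lca (a i) (a j), fun l => by rw [T.lca_anc_iff, S.lca_anc_iff, hmat]⟩
  choose f hf using hTS
  choose g hg using hST
  have extT : ∀ u v, (∀ l, T.Ancestor u (a l) ↔ T.Ancestor v (a l)) → u = v := fun u v h =>
    T.anc_antisymm ((T.anc_iff_leaves a hT2 ha u v).2 fun l => (h l).2)
      ((T.anc_iff_leaves a hT2 ha v u).2 fun l => (h l).1)
  have extS : ∀ u v, (∀ l, S.Ancestor u (b l) ↔ S.Ancestor v (b l)) → u = v := fun u v h =>
    S.anc_antisymm ((S.anc_iff_leaves b hS2 hb u v).2 fun l => (h l).2)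
      ((S.anc_iff_leaves b hS2 hb v u).2 fun l => (h l).1)
  let e : V ≃ W :=
    { toFun := f
      invFun := g
      left_inv := fun u => extT _ _ fun l => (hg (f u) l).trans (hf u l).symm
      right_inv := fun w => extS _ _ fun l => (hf (g w) l).symm.trans (hg w l) }
  have he : ∀ u l, T.Ancestor u (a l) ↔ S.Ancestor (e u) (b l) := hf
  have hanc : ∀ u v, S.Ancestor (e u) (e v) ↔ T.Ancestor u v := by
    intro u v
    rw [T.anc_iff_leaves a hT2 ha, S.anc_iff_leaves b hS2 hb]
    simp only [he]
  have hchild : ∀ u v, S.IsChild (e u) (e v) ↔ T.IsChild u v := by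
    intro u v
    rw [T.child_iff, S.child_iff, ← e.forall_congr_right]
    simp only [hanc, ne_eq, e.apply_eq_iff_eq]
  refine ⟨⟨e, ?_⟩, ?_, ?_⟩
  · intro u v
    rw [S.adj_iff, T.adj_iff, hchild, hchild]
  · change e T.root = S.root
    refine S.anc_antisymm ?_ (S.anc_root _)
    obtain ⟨u, hu⟩ := e.surjective S.root
    rw [← hu, hanc]
    exact T.anc_root u
  · intro i
    change e (a i) = b i
    apply extS
    intro l
    rw [← he]
    conv_lhs => rw [← T.lca_self (a i)]
    conv_rhs => rw [← S.lca_self (b i)]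
    rw [T.lca_anc_iff, S.lca_anc_iff, hmat]
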